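/- Let n ≥ 1, let U ⊆ ℝⁿ be an open set with ℝ^{>0}·U ⊆ U, let k > 1 be real, and let h : U → ℝ be smooth, positive, and positively homogeneous of degree k. Set g_U(x) = −(D²h)ₓ, a symmetric bilinear form on ℝⁿ, and assume that for every x ∈ U the restriction of g_U(x) to the hyperplane ker((Dh)ₓ) is positive definite. Then for every x ∈ U: g_U(x)(x, x) = −k(k−1)h(x) < 0, and the symmetric bilinear form ǧ(x)(u, v) = g_U(x)(u, v) − g_U(x)(x, u)·g_U(x)(x, v)/g_U(x)(x, x) is positive semidefinite with kernel exactly ℝ·x, i.e., ǧ(x)(v, v) ≥ 0 for all v, and ǧ(x)(v, w) = 0 for all w ∈ ℝⁿ if and only if v ∈ ℝ·x. -/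

import Mathlib

noncomputable section

/-- The second derivative of `h` at `x`, as a bilinear form: `(D²h)ₓ(u, v)`. -/
def D2 {n : ℕ} (h : (Fin n → ℝ) → ℝ) (x u v : Fin n → ℝ) : ℝ :=
  fderiv ℝ (fderiv ℝ h) x u v

/-- The symmetric bilinear form `g_U(x) = −(D²h)ₓ`. -/
def gU {n : ℕ} (h : (Fin n → ℝ) → ℝ) (x u v : Fin n → ℝ) : ℝ := -D2 h x u v

/-- The symmetric bilinear form
`ǧ(x)(u, v) = g_U(x)(u, v) − g_U(x)(x, u)·g_U(x)(x, v)/g_U(x)(x, x)`. -/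
def gcheck {n : ℕ} (h : (Fin n → ℝ) → ℝ) (x u v : Fin n → ℝ) : ℝ :=
  gU h x u v - gU h x x u * gU h x x v / gU h x x x

/-- **Euler's identity** for a function positively homogeneous of degree `k` along the ray
through `x`. -/
theorem fderiv_apply_self_of_homogeneous {E : Type*} [NormedAddCommGroup E] [NormedSpace ℝ E]
    {h : E → ℝ} {k : ℝ} {x : E} (hd : DifferentiableAt ℝ h x)
    (hhom : ∀ l : ℝ, 0 < l → h (l • x) = l ^ k * h x) :
    fderiv ℝ h x x = k * h x := by
  have hray : HasDerivAt (fun l : ℝ => l • x) x 1 := by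
    simpa using (hasDerivAt_id (1 : ℝ)).smul_const x
  have hchain : HasDerivAt (fun l : ℝ => h (l • x)) (fderiv ℝ h x x) 1 := by
    have hd' : HasFDerivAt h (fderiv ℝ h x) ((1 : ℝ) • x) := by
      simpa using hd.hasFDerivAt
    exact hd'.comp_hasDerivAt (1 : ℝ) hray
  have hpow : HasDerivAt (fun l : ℝ => l ^ k * h x) (k * h x) 1 := by
    simpa using (Real.hasDerivAt_rpow_const (x := 1) (p := k) (Or.inl one_ne_zero)).mul_const (h x)
  refine hchain.unique (hpow.congr_of_eventuallyEq ?_)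
  filter_upwards [lt_mem_nhds (zero_lt_one' ℝ)] with l hl using hhom l hl

/-- The derivative of Euler's identity: contracting the second derivative with the base point
gives `(k - 1)` times the first derivative. -/
theorem fderiv_fderiv_apply_self_of_euler {E : Type*} [NormedAddCommGroup E] [NormedSpace ℝ E]
    {h : E → ℝ} {k : ℝ} {x : E} (hd : DifferentiableAt ℝ h x)
    (hd2 : DifferentiableAt ℝ (fderiv ℝ h) x)
    (heuler : ∀ᶠ y in nhds x, fderiv ℝ h y y = k * h y) (u : E) :
    fderiv ℝ (fderiv ℝ h) x u x = (k - 1) * fderiv ℝ h x u := by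
  have hl := hd2.hasFDerivAt.clm_apply (hasFDerivAt_id x)
  have hr := (hd.hasFDerivAt.const_mul k).congr_of_eventuallyEq heuler
  have := DFunLike.congr_fun (hl.unique hr) u
  simp at this
  linarith

/-- Let `h` be smooth, positive and positively homogeneous of degree `k > 1` on an
open cone `U ⊆ ℝⁿ`, with `g_U(x) = −(D²h)ₓ` positive definite on `ker (Dh)ₓ` for all
`x ∈ U`.  Then `g_U(x)(x, x) = −k(k−1)h(x) < 0`, and `ǧ(x)` is positive semidefinite
with kernel exactly `ℝ·x`. -/
theorem stmt12 {n : ℕ} (hn : 1 ≤ n)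
    (U : Set (Fin n → ℝ)) (hU : IsOpen U)
    (hcone : ∀ l : ℝ, 0 < l → ∀ x ∈ U, l • x ∈ U)
    (k : ℝ) (hk : 1 < k)
    (h : (Fin n → ℝ) → ℝ) (hsm : ContDiffOn ℝ (⊤ : ℕ∞) h U)
    (hpos : ∀ x ∈ U, 0 < h x)
    (hhom : ∀ l : ℝ, 0 < l → ∀ x ∈ U, h (l • x) = l ^ k * h x)
    (hker : ∀ x ∈ U, ∀ v : Fin n → ℝ, fderiv ℝ h x v = 0 → v ≠ 0 → 0 < gU h x v v) :
    ∀ x ∈ U,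
      (gU h x x x = -(k * (k - 1) * h x) ∧ gU h x x x < 0) ∧
      (∀ v : Fin n → ℝ, 0 ≤ gcheck h x v v) ∧
      (∀ v : Fin n → ℝ, (∀ w : Fin n → ℝ, gcheck h x v w = 0) ↔ ∃ t : ℝ, v = t • x) := by
  intro x hx
  have hsmooth : ∀ y ∈ U, ContDiffAt ℝ (⊤ : ℕ∞) h y := fun y hy =>
    hsm.contDiffAt (hU.mem_nhds hy)
  have hdiff : ∀ y ∈ U, DifferentiableAt ℝ h y := fun y hy =>
    (hsmooth y hy).differentiableAt (by simp)
  have heuler : ∀ y ∈ U, fderiv ℝ h y y = k * h y := fun y hy =>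
    fderiv_apply_self_of_homogeneous (hdiff y hy) fun l hl => hhom l hl y hy
  have hC2 : ContDiffAt ℝ 2 h x :=
    (hsmooth x hx).of_le (WithTop.coe_le_coe.2 (le_top : (2 : ℕ∞) ≤ ⊤))
  have hd2 : DifferentiableAt ℝ (fderiv ℝ h) x :=
    (hC2.fderiv_right (m := 1) (by norm_num)).differentiableAt (by simp)
  have hright : ∀ u, gU h x u x = -((k - 1) * fderiv ℝ h x u) := fun u => by
    rw [gU, D2, fderiv_fderiv_apply_self_of_euler (hdiff x hx) hd2
      (Filter.eventually_of_mem (hU.mem_nhds hx) heuler)]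
  have hsymm : ∀ u v, gU h x u v = gU h x v u := fun u v => by
    have : IsSymmSndFDerivAt ℝ h x := hC2.isSymmSndFDerivAt (by simp)
    rw [gU, gU, D2, D2, this.eq]
  have hleft : ∀ u, gU h x x u = -((k - 1) * fderiv ℝ h x u) := fun u => by
    rw [hsymm, hright]
  have hself : gU h x x x = -(k * (k - 1) * h x) := by
    rw [hright, heuler x hx]; ring
  have hhx := hpos x hx
  have hk1 : 0 < k - 1 := sub_pos.2 hk
  have hk0 : 0 < k := one_pos.trans hk
  have hneg : gU h x x x < 0 := by
    rw [hself]; exact neg_neg_of_pos (by positivity)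
  -- `ǧ(x)(v, v)` is the value of `g_U(x)` on the projection of `v` to `ker (Dh)ₓ` along `x`.
  have hproj : ∀ v, fderiv ℝ h x (v - (fderiv ℝ h x v / (k * h x)) • x) = 0 := fun v => by
    rw [map_sub, map_smul, heuler x hx, smul_eq_mul]
    field_simp
    ring
  have hexpand : ∀ (v : Fin n → ℝ) (t : ℝ), gU h x (v - t • x) (v - t • x) =
      gU h x v v - t * gU h x v x - t * gU h x x v + t ^ 2 * gU h x x x := fun v t => by
    simp only [gU, D2, map_sub, map_smul, sub_apply, smul_apply, smul_eq_mul]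
    ring
  have hcheck : ∀ v, gcheck h x v v = gU h x (v - (fderiv ℝ h x v / (k * h x)) • x)
      (v - (fderiv ℝ h x v / (k * h x)) • x) := fun v => by
    rw [hexpand, gcheck, hself, hright, hleft]
    field_simp
    ring
  refine ⟨⟨hself, hneg⟩, fun v => ?_, fun v => ⟨fun hv => ?_, ?_⟩⟩
  · rw [hcheck]
    by_cases h0 : v - (fderiv ℝ h x v / (k * h x)) • x = 0
    · simp [h0, gU, D2]
    · exact (hker x hx _ (hproj v) h0).le
  · refine ⟨fderiv ℝ h x v / (k * h x), sub_eq_zero.1 ?_⟩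
    by_contra h0
    exact (hker x hx _ (hproj v) h0).ne' ((hcheck v).symm.trans (hv v))
  · rintro ⟨t, rfl⟩ w
    have hsmulleft : gU h x (t • x) w = t * gU h x x w := by simp [gU, D2]
    have hsmulright : gU h x x (t • x) = t * gU h x x x := by simp [gU, D2]
    rw [gcheck, hsmulleft, hsmulright]
    field_simp [hneg.ne]
    ring
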